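/- arXiv:1911.07375 — 4 statements merged into one kernel-verified Lean document; each statement's English description precedes it below -/
import Mathlib

section
/- For each h ≥ 1, let x* = (0,0,1,1) and define the monotone function f_h on the 5h+1 variables x^{(1)},…,x^{(h)} ∈ {0,1}^4, y^{(1)},…,y^{(h)} ∈ {0,1}, z ∈ {0,1} by: f_0(z) = +1 if z=1 else −1; and f_h = f_{h−1} if x^{(h)} = x*; f_h = +1 if x^{(h)} ⪰ x* and x^{(h)} ≠ x*; f_h = −1 if x^{(h)} ⪯ x* and x^{(h)} ≠ x*; and f_h = (+1 if y^{(h)}=1 else −1) otherwise. Then each f_h is monotone, its optimal decision tree size is at most C·h + C for some absolute constant C, yet BuildTopDownDT(f_h, 0) — regardless of how ties are broken — outputs a tree of size at least 2^h. Consequently there are monotone functions with optimal size s = Θ(n) and TopDownDTSize(f) ≥ 2^{Ω(s)}. -/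
/- Common definitions: decision trees, bare trees, influence, and the
   BuildTopDownDT top-down heuristic (modelled as a nondeterministic step
   relation, so that all tie-breakings are covered). -/

noncomputable section

namespace TopDownDT

/-- Influence of variable `i` on a Boolean function over a finite index set
(`true` codes +1, `false` codes −1). -/
def influence {I : Type} [Fintype I] [DecidableEq I]
    (f : (I → Bool) → Bool) (i : I) : ℝ :=
  ((Finset.univ.filter fun x : I → Bool =>
      f x ≠ f (Function.update x i (!x i))).card : ℝ) / 2 ^ Fintype.card I

/-- Total influence. -/
def totalInfluence {I : Type} [Fintype I] [DecidableEq I]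
    (f : (I → Bool) → Bool) : ℝ :=
  ∑ i : I, influence f i

variable {n : ℕ}

/-- Override inputs according to a partial assignment (earlier entries take precedence). -/
def override (π : List (Fin n × Bool)) (x : Fin n → Bool) : Fin n → Bool :=
  fun i =>
    match π.find? (fun p => decide (p.1 = i)) with
    | some p => p.2
    | none => x i

/-- Restriction of `f` by the partial assignment `π` (as a function on the whole cube;
the fixed coordinates become irrelevant). -/
def restrictList (f : (Fin n → Bool) → Bool) (π : List (Fin n × Bool)) :
    (Fin n → Bool) → Bool :=
  fun x => f (override π x)

/-- Decision trees with ±1 leaves (`true` codes +1, `false` codes −1). -/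
inductive DecTree (n : ℕ) : Type
  | leaf : Bool → DecTree n
  | node : Fin n → DecTree n → DecTree n → DecTree n
  deriving DecidableEq

/-- Evaluation of a decision tree. -/
def DecTree.eval : DecTree n → (Fin n → Bool) → Bool
  | .leaf b, _ => b
  | .node i t0 t1, x => if x i then t1.eval x else t0.eval x

/-- Size (number of leaves) of a decision tree. -/
def DecTree.size : DecTree n → ℕ
  | .leaf _ => 1
  | .node _ t0 t1 => t0.size + t1.size

/-- Depth of a decision tree. -/
def DecTree.depth : DecTree n → ℕ
  | .leaf _ => 0
  | .node _ t0 t1 => max t0.depth t1.depth + 1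

/-- Number of queries the tree makes on input `x` (the depth of the leaf reached by `x`). -/
def DecTree.pathLen : DecTree n → (Fin n → Bool) → ℕ
  | .leaf _, _ => 0
  | .node i t0 t1, x => (if x i then t1.pathLen x else t0.pathLen x) + 1

/-- The optimal decision tree size of `f`: the least size of a decision tree computing `f`. -/
def optSize (f : (Fin n → Bool) → Bool) : ℕ :=
  sInf {s : ℕ | ∃ T : DecTree n, (∀ x, T.eval x = f x) ∧ T.size = s}

/-- Bare trees: decision trees with unlabeled leaves. -/
inductive BareTree (n : ℕ) : Type
  | leaf : BareTree n
  | node : Fin n → BareTree n → BareTree n → BareTree n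
  deriving DecidableEq

/-- Size (number of leaves) of a bare tree. -/
def BareTree.size : BareTree n → ℕ
  | .leaf => 1
  | .node _ t0 t1 => t0.size + t1.size

/-- Root-to-leaf paths of a bare tree, recorded as lists of (variable, value) pairs. -/
def BareTree.leafPaths : BareTree n → List (List (Fin n × Bool))
  | .leaf => [[]]
  | .node i t0 t1 =>
      (t0.leafPaths.map fun p => (i, false) :: p) ++
      (t1.leafPaths.map fun p => (i, true) :: p)

/-- Replace the leaf at the end of the path `π` by the bare tree `t`. -/
def BareTree.replaceLeaf : BareTree n → List (Fin n × Bool) → BareTree n → BareTree n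
  | .leaf, [], t => t
  | .leaf, _ :: _, _ => .leaf
  | .node i t0 t1, [], _ => .node i t0 t1
  | .node i t0 t1, p :: ps, t =>
      if p.2 then .node i t0 (t1.replaceLeaf ps t)
      else .node i (t0.replaceLeaf ps t) t1

/-- The `f`-completion: label each leaf `ℓ` by the sign of `E[f_ℓ]`. -/
def completionAux (f : (Fin n → Bool) → Bool) :
    BareTree n → List (Fin n × Bool) → DecTree n
  | .leaf, π =>
      .leaf (decide (2 ^ n ≤ 2 * (Finset.univ.filter fun x => restrictList f π x = true).card))
  | .node i t0 t1, π =>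
      .node i (completionAux f t0 (π ++ [(i, false)]))
              (completionAux f t1 (π ++ [(i, true)]))

/-- The `f`-completion of a bare tree. -/
def completion (f : (Fin n → Bool) → Bool) (T : BareTree n) : DecTree n :=
  completionAux f T []

/-- Fraction of points of the cube on which `f` and `g` disagree. -/
def errf (f g : (Fin n → Bool) → Bool) : ℝ :=
  ((Finset.univ.filter fun x => f x ≠ g x).card : ℝ) / 2 ^ n

/-- Error of the `f`-completion of a bare tree with respect to `f`. -/
def completionErr (f : (Fin n → Bool) → Bool) (T : BareTree n) : ℝ :=
  errf f (completion f T).eval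

/-- Score of the leaf with path `π`: `2^{-|ℓ|} · max_i Inf_i(f_ℓ)`. -/
def leafScore (f : (Fin n → Bool) → Bool) (π : List (Fin n × Bool)) : ℝ :=
  ((1 : ℝ) / 2) ^ π.length * ⨆ i : Fin n, influence (restrictList f π) i

/-- `i` is a most influential variable of `g`. -/
def IsMaxInfl (g : (Fin n → Bool) → Bool) (i : Fin n) : Prop :=
  ∀ j : Fin n, influence g j ≤ influence g i

/-- One step of BuildTopDownDT: replace a maximum-score leaf by a query to a most
influential variable of the corresponding restriction of `f`. -/
def SplitStep (f : (Fin n → Bool) → Bool) (T T' : BareTree n) : Prop :=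
  ∃ π ∈ T.leafPaths, ∃ i : Fin n,
    (∀ π' ∈ T.leafPaths, leafScore f π' ≤ leafScore f π) ∧
    IsMaxInfl (restrictList f π) i ∧
    T' = T.replaceLeaf π (.node i .leaf .leaf)

/-- A (partial) run of `BuildTopDownDT(f, ε)` of length `m`, under an arbitrary
tie-breaking rule: it starts from the single unlabeled leaf and, as long as the
`f`-completion is not an `ε`-approximation of `f`, performs a valid split. -/
def IsRun (f : (Fin n → Bool) → Bool) (ε : ℝ) (m : ℕ) (g : ℕ → BareTree n) : Prop :=
  g 0 = BareTree.leaf ∧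
  ∀ j < m, ε < completionErr f (g j) ∧ SplitStep f (g j) (g (j + 1))

/-- Monotonicity of a Boolean function (with `false ≤ true`). -/
def MonotoneBF (f : (Fin n → Bool) → Bool) : Prop :=
  ∀ x y : Fin n → Bool, (∀ i, x i ≤ y i) → f x ≤ f y

/-- Cost of a bare tree relative to `f`:  `Σ_ℓ 2^{-|ℓ|} · Inf(f_ℓ)`. -/
def costf (f : (Fin n → Bool) → Bool) (T : BareTree n) : ℝ :=
  (T.leafPaths.map fun π =>
    ((1 : ℝ) / 2) ^ π.length * totalInfluence (restrictList f π)).sum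

/-- Variance of a Boolean function: `4 · Pr[f = −1] · Pr[f = +1]`. -/
def varf (f : (Fin n → Bool) → Bool) : ℝ :=
  4 * (((Finset.univ.filter fun x => f x = false).card : ℝ) / 2 ^ n) *
      (((Finset.univ.filter fun x => f x = true).card : ℝ) / 2 ^ n)

/-- Expectation `E[f(x)]` of a ±1-valued Boolean function over a uniform input. -/
def expVal (f : (Fin n → Bool) → Bool) : ℝ :=
  (∑ x : Fin n → Bool, if f x then (1 : ℝ) else -1) / 2 ^ n

end TopDownDT

open TopDownDT

/-- The special point `x* = (0,0,1,1)`. -/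
def xstar : Fin 4 → Bool := ![false, false, true, true]

/-- The monotone function `f_h` on the `5h+1` variables
`z` (index `0`), `x⁽ʲ⁾ ∈ {0,1}⁴` (indices `5(j-1)+1,…,5(j-1)+4`), `y⁽ʲ⁾` (index `5j`):
`f_0(z) = z`; `f_h = f_{h-1}` if `x⁽ʰ⁾ = x*`; `f_h = +1` if `x⁽ʰ⁾ ⪰ x*`, `x⁽ʰ⁾ ≠ x*`;
`f_h = −1` if `x⁽ʰ⁾ ⪯ x*`, `x⁽ʰ⁾ ≠ x*`; and `f_h = y⁽ʰ⁾` otherwise.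
(`true` codes +1, `false` codes −1.) -/
def monoChainF : ℕ → (ℕ → Bool) → Bool
  | 0, x => x 0
  | h + 1, x =>
      let a : Fin 4 → Bool := fun k => x (5 * h + 1 + (k : ℕ))
      if a = xstar then monoChainF h x
      else if ∀ k, xstar k ≤ a k then true
      else if ∀ k, a k ≤ xstar k then false
      else x (5 * h + 5)

/-- `f_h` as a function on the cube `{0,1}^{5h+1}`. -/
def monoChainFun (h : ℕ) : (Fin (5 * h + 1) → Bool) → Bool :=
  fun x => monoChainF h fun i => if hi : i < 5 * h + 1 then x ⟨i, hi⟩ else false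

namespace TopDownDT

/-! ### Influences and sensitive points -/

section Sensitivity

variable {n : ℕ}

/-- The set of inputs at which flipping coordinate `i` changes the value of `g`. -/
def sensitive (g : (Fin n → Bool) → Bool) (i : Fin n) : Finset (Fin n → Bool) :=
  Finset.univ.filter fun x => g x ≠ g (Function.update x i (!x i))

lemma mem_sensitive {g : (Fin n → Bool) → Bool} {i : Fin n} {x : Fin n → Bool} :
    x ∈ sensitive g i ↔ g x ≠ g (Function.update x i (!x i)) := by
  simp [sensitive]

lemma influence_eq (g : (Fin n → Bool) → Bool) (i : Fin n) :
    influence g i = ((sensitive g i).card : ℝ) / 2 ^ Fintype.card (Fin n) := rfl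

lemma influence_nonneg (g : (Fin n → Bool) → Bool) (i : Fin n) : 0 ≤ influence g i := by
  rw [influence_eq]; positivity

lemma influence_lt_of_card_lt {g : (Fin n → Bool) → Bool} {i j : Fin n}
    (h : (sensitive g i).card < (sensitive g j).card) : influence g i < influence g j := by
  rw [influence_eq, influence_eq]
  have : ((sensitive g i).card : ℝ) < (sensitive g j).card := by exact_mod_cast h
  gcongr

lemma influence_eq_zero_of_indep {g : (Fin n → Bool) → Bool} {i : Fin n}
    (h : ∀ x b, g (Function.update x i b) = g x) : influence g i = 0 := by
  have : sensitive g i = ∅ := by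
    ext x
    simp [mem_sensitive, h]
  simp [influence_eq, this]

end Sensitivity

/-! ### Trees grown by splitting on most influential variables -/

section Greedy

variable {n : ℕ}

/-- Every internal node of the tree queries a most influential variable of the restriction
of `g` reaching it. -/
def SplitsOnMaxInfl : ((Fin n → Bool) → Bool) → BareTree n → Prop
  | _, .leaf => True
  | g, .node i t0 t1 =>
      IsMaxInfl g i ∧
      SplitsOnMaxInfl (fun x => g (Function.update x i false)) t0 ∧
      SplitsOnMaxInfl (fun x => g (Function.update x i true)) t1

/-- The tree queries most influential variables and all of its leaves that are reachable
through queries of positive influence carry constant restrictions of `g`. -/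
def ExactGreedy : ((Fin n → Bool) → Bool) → BareTree n → Prop
  | g, .leaf => ∃ b, ∀ x, g x = b
  | g, .node i t0 t1 =>
      IsMaxInfl g i ∧ (0 < influence g i →
        ExactGreedy (fun x => g (Function.update x i false)) t0 ∧
        ExactGreedy (fun x => g (Function.update x i true)) t1)

lemma override_cons (i : Fin n) (b : Bool) (π : List (Fin n × Bool)) (x : Fin n → Bool) :
    override ((i, b) :: π) x = Function.update (override π x) i b := by
  funext j
  by_cases h : i = j
  · subst h; simp [override]
  · simp [override, h, Function.update_of_ne (Ne.symm h)]

lemma override_append (i : Fin n) (b : Bool) (π : List (Fin n × Bool)) (x : Fin n → Bool) :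
    override (π ++ [(i, b)]) x = override π (Function.update x i b) := by
  induction π with
  | nil => rw [List.nil_append, override_cons]; rfl
  | cons p π ih => obtain ⟨j, c⟩ := p; rw [List.cons_append, override_cons, override_cons, ih]

lemma restrictList_cons (g : (Fin n → Bool) → Bool) (i : Fin n) (b : Bool)
    (π : List (Fin n × Bool)) :
    restrictList g ((i, b) :: π) = restrictList (fun x => g (Function.update x i b)) π := by
  funext x
  simp [restrictList, override_cons]

lemma restrictList_append (g : (Fin n → Bool) → Bool) (i : Fin n) (b : Bool)
    (π : List (Fin n × Bool)) :
    restrictList g (π ++ [(i, b)]) = fun x => restrictList g π (Function.update x i b) := by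
  funext x
  simp [restrictList, override_append]

lemma override_apply_of_notMem {π : List (Fin n × Bool)} {i : Fin n} (h : i ∉ π.map Prod.fst)
    (x : Fin n → Bool) : override π x i = x i := by
  induction π with
  | nil => rfl
  | cons p π ih =>
    obtain ⟨j, c⟩ := p
    simp only [List.map_cons, List.mem_cons, not_or] at h
    rw [override_cons, Function.update_of_ne h.1, ih h.2]

lemma override_update_of_mem {π : List (Fin n × Bool)} {i : Fin n} (h : i ∈ π.map Prod.fst)
    (x : Fin n → Bool) (b : Bool) : override π (Function.update x i b) = override π x := by
  induction π with
  | nil => simp at h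
  | cons p π ih =>
    obtain ⟨j, c⟩ := p
    rw [override_cons, override_cons]
    by_cases hj : i ∈ π.map Prod.fst
    · rw [ih hj]
    · have hij : i = j := by simpa [hj] using h
      subst hij
      funext k
      by_cases hk : k = i
      · subst hk; simp
      · simp only [Function.update_of_ne hk]
        unfold override
        split
        · rfl
        · rw [Function.update_of_ne hk]

lemma SplitsOnMaxInfl.replaceLeaf {T : BareTree n} {g : (Fin n → Bool) → Bool}
    {π : List (Fin n × Bool)} {i : Fin n} (hT : SplitsOnMaxInfl g T) (hπ : π ∈ T.leafPaths)
    (hi : IsMaxInfl (restrictList g π) i) :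
    SplitsOnMaxInfl g (T.replaceLeaf π (.node i .leaf .leaf)) := by
  induction T generalizing g π with
  | leaf =>
    simp only [BareTree.leafPaths, List.mem_singleton] at hπ
    subst hπ
    exact ⟨hi, trivial, trivial⟩
  | node j t0 t1 ih0 ih1 =>
    obtain ⟨hj, h0, h1⟩ := hT
    simp only [BareTree.leafPaths, List.mem_append, List.mem_map] at hπ
    rcases hπ with ⟨p, hp, rfl⟩ | ⟨p, hp, rfl⟩
    · rw [restrictList_cons] at hi
      simpa [BareTree.replaceLeaf, SplitsOnMaxInfl] using ⟨hj, ih0 h0 hp hi, h1⟩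
    · rw [restrictList_cons] at hi
      simpa [BareTree.replaceLeaf, SplitsOnMaxInfl] using ⟨hj, h0, ih1 h1 hp hi⟩

lemma IsRun.splitsOnMaxInfl {f : (Fin n → Bool) → Bool} {ε : ℝ} {m : ℕ} {g : ℕ → BareTree n}
    (hg : IsRun f ε m g) : ∀ j ≤ m, SplitsOnMaxInfl f (g j) := by
  intro j
  induction j with
  | zero => intro _; rw [hg.1]; trivial
  | succ j ih =>
    intro hj
    obtain ⟨-, π, hπ, i, -, hi, hT⟩ := hg.2 j (by omega)
    rw [hT]
    exact (ih (by omega)).replaceLeaf hπ hi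

lemma SplitsOnMaxInfl.exactGreedy {f : (Fin n → Bool) → Bool} {T : BareTree n}
    {π : List (Fin n × Bool)} (hT : SplitsOnMaxInfl (restrictList f π) T)
    (hc : ∀ x, (completionAux f T π).eval (override π x) = f (override π x)) :
    ExactGreedy (restrictList f π) T := by
  induction T generalizing π with
  | leaf => exact ⟨_, fun x => (hc x).symm⟩
  | node i t0 t1 ih0 ih1 =>
    obtain ⟨hi, h0, h1⟩ := hT
    refine ⟨hi, fun hpos => ?_⟩
    have hmem : i ∉ π.map Prod.fst := fun hmem =>
      hpos.ne' <| influence_eq_zero_of_indep fun x b => by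
        simp [restrictList, override_update_of_mem hmem]
    rw [← restrictList_append] at h0 h1 ⊢
    rw [← restrictList_append]
    refine ⟨ih0 h0 fun x => ?_, ih1 h1 fun x => ?_⟩
    · have := hc (Function.update x i false)
      rw [override_append]
      simpa [completionAux, DecTree.eval, override_apply_of_notMem hmem] using this
    · have := hc (Function.update x i true)
      rw [override_append]
      simpa [completionAux, DecTree.eval, override_apply_of_notMem hmem] using this

lemma eq_of_errf_nonpos {f g : (Fin n → Bool) → Bool} (h : errf f g ≤ 0) (x : Fin n → Bool) :
    f x = g x := by
  by_contra hx
  have : 0 < (Finset.univ.filter fun x => f x ≠ g x).card :=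
    Finset.card_pos.2 ⟨x, by simpa using hx⟩
  have : (0 : ℝ) < errf f g := by
    unfold errf
    positivity
  linarith

lemma IsRun.exactGreedy {f : (Fin n → Bool) → Bool} {ε : ℝ} {m : ℕ} {g : ℕ → BareTree n}
    (hg : IsRun f ε m g) (herr : completionErr f (g m) ≤ 0) : ExactGreedy f (g m) :=
  SplitsOnMaxInfl.exactGreedy (π := []) (hg.splitsOnMaxInfl m le_rfl)
    fun x => (eq_of_errf_nonpos herr x).symm

lemma BareTree.one_le_size (T : BareTree n) : 1 ≤ T.size := by
  induction T with
  | leaf => exact le_rfl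
  | node i t0 t1 ih0 ih1 => simp only [BareTree.size]; omega

end Greedy

/-! ### Guarded functions

A function `g` is guarded by the variables in `V` with key `c` if it agrees with `f` when the
variables in `V` are set according to `c`, and only depends on the variables in `V` otherwise. -/

section Guarded

variable {n : ℕ}

/-- `g` agrees with `f` on inputs matching `c` on `V`, and depends only on the coordinates
in `V` on the other inputs. -/
structure Guarded (f g : (Fin n → Bool) → Bool) (V : Finset (Fin n)) (c : Fin n → Bool) :
    Prop where
  indep : ∀ x x', (∀ i, i ∉ V → x i = x' i) → f x = f x'
  unlocked : ∀ x, (∀ v ∈ V, x v = c v) → g x = f x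
  locked : ∀ x x', (∀ v ∈ V, x v = x' v) → (¬ ∀ v ∈ V, x v = c v) → g x = g x'

variable {f g : (Fin n → Bool) → Bool} {V : Finset (Fin n)} {c : Fin n → Bool}

lemma Guarded.card_sensitive_lt (hg : Guarded f g V c)
    (hf : ∀ j b, ∃ z, f z = b ∧ f (Function.update z j (!z j)) = b)
    {v j : Fin n} (hv : v ∈ V) (hj : j ∉ V) :
    (sensitive g j).card < (sensitive g v).card := by
  have hvj : v ≠ j := fun h => hj (h ▸ hv)
  set b : Bool := !g (Function.update c v (!c v)) with hb
  have hflock : ∀ x, (∀ u ∈ V, u ≠ v → x u = c u) → x v = !c v → g x = !b := by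
    intro x hx hxv
    rw [hb, Bool.not_not]
    refine hg.locked _ _ (fun u hu => ?_) (fun h => ?_)
    · by_cases huv : u = v
      · subst huv; simp [hxv]
      · rw [Function.update_of_ne huv, hx u hu huv]
    · have := h v hv; rw [hxv] at this; simp at this
  have hmem : ∀ x, (∀ u ∈ V, u ≠ v → x u = c u) → f x = b → x ∈ sensitive g v := by
    intro x hx hfx
    rw [mem_sensitive]
    have key : ∀ w : Fin n → Bool, (∀ u ∈ V, u ≠ v → w u = c u) → w v = c v → f w = b →
        g w = b := by
      intro w hw hwv hfw
      rw [hg.unlocked w fun u hu => ?_, hfw]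
      by_cases huv : u = v
      · rw [huv, hwv]
      · exact hw u hu huv
    have hupd : ∀ d, ∀ u ∈ V, u ≠ v → Function.update x v d u = c u := fun d u hu huv => by
      rw [Function.update_of_ne huv, hx u hu huv]
    have hfupd : ∀ d, f (Function.update x v d) = b := fun d => by
      rw [← hfx]
      refine hg.indep _ _ fun i hi => Function.update_of_ne (ne_of_mem_of_not_mem hv hi).symm _ _
    by_cases hxv : x v = c v
    · rw [key x hx hxv hfx, hflock _ (hupd _) (by simp [hxv])]
      simp
    · have hxv' : x v = !c v := by simpa using Bool.eq_not_of_ne hxv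
      rw [hflock x hx hxv', key _ (hupd _) (by simp [hxv']) (hfupd _)]
      simp
  have hsens : ∀ x ∈ sensitive g j, (∀ u ∈ V, x u = c u) ∧
      f x ≠ f (Function.update x j (!x j)) := by
    intro x hx
    rw [mem_sensitive] at hx
    have hagree : ∀ u ∈ V, x u = Function.update x j (!x j) u := fun u hu =>
      (Function.update_of_ne (ne_of_mem_of_not_mem hu hj) _ _).symm
    by_cases hxc : ∀ u ∈ V, x u = c u
    · refine ⟨hxc, ?_⟩
      rwa [hg.unlocked x hxc, hg.unlocked _ fun u hu => (hagree u hu).symm.trans (hxc u hu)] at hx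
    · exact absurd (hg.locked _ _ hagree hxc) hx
  obtain ⟨z, hz, hz'⟩ := hf j b
  let z' : Fin n → Bool := fun i => if i ∈ V then c i else z i
  have hz'c : ∀ u ∈ V, z' u = c u := fun u hu => by simp [z', hu]
  have hfz' : f z' = b := hz ▸ hg.indep _ _ fun i hi => by simp [z', hi]
  have hz'j : z' ∉ sensitive g j := fun h => by
    apply (hsens z' h).2
    rw [hfz', ← hz']
    refine hg.indep _ _ fun i hi => ?_
    by_cases hij : i = j
    · subst hij; simp [z', hj]
    · simp [z', hi, hij]
  let φ : (Fin n → Bool) → (Fin n → Bool) := fun x =>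
    if f x = b then x else Function.update (Function.update x j (!x j)) v (!c v)
  have hφ : ∀ x ∈ sensitive g j, φ x ∈ (sensitive g v).erase z' := by
    intro x hx
    obtain ⟨hxc, hfx⟩ := hsens x hx
    by_cases h : f x = b
    · simp only [φ, h, if_true, Finset.mem_erase]
      exact ⟨fun hxz => hz'j (hxz ▸ hx), hmem x (fun u hu _ => hxc u hu) h⟩
    · simp only [φ, h, if_false, Finset.mem_erase]
      refine ⟨fun hxz => ?_, hmem _ (fun u hu huv => ?_) ?_⟩
      · have := congrFun hxz v
        rw [hz'c v hv] at this
        simp at this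
      · rw [Function.update_of_ne huv, Function.update_of_ne (ne_of_mem_of_not_mem hu hj), hxc u hu]
      · rw [hg.indep _ (Function.update x j (!x j)) fun i hi =>
          Function.update_of_ne (ne_of_mem_of_not_mem hv hi).symm _ _]
        cases hb1 : f x <;> cases hb2 : f (Function.update x j (!x j)) <;> simp_all
  have hφinj : Set.InjOn φ (sensitive g j) := by
    intro x hx x' hx' hxx
    have hxv := (hsens x hx).1 v hv
    have hxv' := (hsens x' hx').1 v hv
    by_cases h : f x = b <;> by_cases h' : f x' = b <;>
      simp only [φ, h, h', if_true, if_false] at hxx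
    · exact hxx
    · have := congrFun hxx v
      simp [hxv] at this
    · have := congrFun hxx v
      simp [hxv'] at this
    · funext i
      by_cases hiv : i = v
      · rw [hiv, hxv, hxv']
      · have := congrFun hxx i
        rw [Function.update_of_ne hiv, Function.update_of_ne hiv] at this
        by_cases hij : i = j
        · subst hij; simpa using this
        · simpa [hij] using this
  calc (sensitive g j).card ≤ ((sensitive g v).erase z').card :=
        Finset.card_le_card_of_injOn φ hφ hφinj
    _ < (sensitive g v).card :=
        Finset.card_erase_lt_of_mem (hmem z' (fun u hu _ => hz'c u hu) hfz')

lemma Guarded.restrict (hg : Guarded f g V c) {v : Fin n} (hv : v ∈ V) :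
    Guarded f (fun x => g (Function.update x v (c v))) (V.erase v) c := by
  have hagree : ∀ x y : Fin n → Bool, (∀ u ∈ V.erase v, x u = y u) → y v = c v →
      ∀ u ∈ V, Function.update x v (c v) u = y u := by
    intro x y hxy hyv u hu
    by_cases huv : u = v
    · subst huv; simp [hyv]
    · rw [Function.update_of_ne huv, hxy u (Finset.mem_erase.2 ⟨huv, hu⟩)]
  refine ⟨fun x x' h => hg.indep _ _ fun i hi => h i fun h' => hi (Finset.mem_of_mem_erase h'),
    fun x hx => ?_, fun x x' hxx hx => ?_⟩
  · rw [hg.unlocked _ (hagree x c hx rfl)]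
    exact hg.indep _ _ fun i hi => Function.update_of_ne (ne_of_mem_of_not_mem hv hi).symm _ _
  · refine hg.locked _ _ (hagree _ _ (fun u hu => ?_) (by simp)) fun h => hx fun u hu => ?_
    · rw [Function.update_of_ne (Finset.ne_of_mem_erase hu), hxx u hu]
    · rw [← h u (Finset.mem_of_mem_erase hu), Function.update_of_ne (Finset.ne_of_mem_erase hu)]

/-- A lower bound on exact greedy trees for `f` transfers to functions guarding `f`: the guard
variables are more influential than all others, so they are queried first. -/
lemma Guarded.le_size {N : ℕ} (hN : ∀ T, ExactGreedy f T → N ≤ T.size)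
    (hf : ∀ j b, ∃ z, f z = b ∧ f (Function.update z j (!z j)) = b)
    {w : Fin n} (hw : w ∉ V) (hg : Guarded f g V c) {T : BareTree n} (hT : ExactGreedy g T) :
    N ≤ T.size := by
  induction T generalizing V g with
  | leaf =>
    exfalso
    obtain ⟨b, hb⟩ := hT
    obtain ⟨z, hz, -⟩ := hf w (!b)
    have h1 := hb fun i => if i ∈ V then c i else z i
    rw [hg.unlocked _ fun v hv => by simp [hv], hg.indep _ z fun i hi => by simp [hi], hz] at h1
    simp at h1
  | node i t0 t1 ih0 ih1 =>
    rcases V.eq_empty_or_nonempty with rfl | ⟨v, hv⟩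
    · have : g = f := funext fun x => hg.unlocked x (by simp)
      exact hN _ (this ▸ hT)
    · obtain ⟨hi, hrec⟩ := hT
      have hiV : i ∈ V := by
        by_contra hiV
        exact (hi v).not_gt (influence_lt_of_card_lt (hg.card_sensitive_lt hf hv hiV))
      obtain ⟨h0, h1⟩ := hrec <| (influence_nonneg g w).trans_lt
        (influence_lt_of_card_lt (hg.card_sensitive_lt hf hiV hw))
      have hg' := hg.restrict hiV
      have hw' : w ∉ V.erase i := fun h => hw (Finset.mem_of_mem_erase h)
      simp only [BareTree.size]
      cases hci : c i <;> rw [hci] at hg'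
      · exact (ih0 hw' hg' h0).trans (Nat.le_add_right _ _)
      · exact (ih1 hw' hg' h1).trans (Nat.le_add_left _ _)

end Guarded

/-! ### One block of the chain -/

section Block

variable {n : ℕ}

/-- The function that reads the four variables `e` and the variable `y`, and passes to `f` when
the variables `e` spell `xstar`. -/
def blockFun (f : (Fin n → Bool) → Bool) (e : Fin 4 → Fin n) (y : Fin n) :
    (Fin n → Bool) → Bool := fun x =>
  if x ∘ e = xstar then f x
  else if ∀ k, xstar k ≤ x (e k) then true
  else if ∀ k, x (e k) ≤ xstar k then false
  else x y

lemma card_fiber_le {e : Fin 4 → Fin n} (he : Function.Injective e) (p q : Fin 4 → Bool) :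
    (Finset.univ.filter fun x : Fin n → Bool => x ∘ e = p).card ≤
      (Finset.univ.filter fun x : Fin n → Bool => x ∘ e = q).card := by
  refine Finset.card_le_card_of_injOn (fun x => Function.extend e q x) (fun x _ => ?_) ?_
  · simp [Function.extend_comp he]
  · intro x hx x' hx' h
    simp only [Finset.coe_filter, Finset.mem_univ, true_and, Set.mem_ofPred_eq] at hx hx'
    funext i
    by_cases hi : ∃ k, e k = i
    · obtain ⟨k, rfl⟩ := hi
      exact (congrFun hx k).trans (congrFun hx' k).symm
    · simpa [Function.extend_apply' _ _ _ hi] using congrFun h i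

lemma card_filter_comp_lt {e : Fin 4 → Fin n} (he : Function.Injective e)
    {P Q : Finset (Fin 4 → Bool)} (h : P.card < Q.card) :
    (Finset.univ.filter fun x : Fin n → Bool => x ∘ e ∈ P).card <
      (Finset.univ.filter fun x : Fin n → Bool => x ∘ e ∈ Q).card := by
  have hcard : ∀ R : Finset (Fin 4 → Bool),
      (Finset.univ.filter fun x : Fin n → Bool => x ∘ e ∈ R).card =
        R.card * (Finset.univ.filter fun x : Fin n → Bool => x ∘ e = xstar).card := by
    intro R
    rw [Finset.card_eq_sum_card_fiberwise (f := fun x : Fin n → Bool => x ∘ e) (t := R)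
      (fun x hx => by simpa using hx), ← smul_eq_mul, ← Finset.sum_const]
    refine Finset.sum_congr rfl fun p hp => ?_
    rw [Finset.filter_filter]
    have : (Finset.univ.filter fun x : Fin n → Bool => x ∘ e ∈ R ∧ x ∘ e = p) =
        Finset.univ.filter fun x : Fin n → Bool => x ∘ e = p :=
      Finset.filter_congr fun x _ => ⟨fun hx => hx.2, fun hx => ⟨hx ▸ hp, hx⟩⟩
    rw [this]
    exact (card_fiber_le he _ _).antisymm (card_fiber_le he _ _)
  rw [hcard, hcard]
  refine Nat.mul_lt_mul_of_pos_right h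
    (Finset.card_pos.2 ⟨Function.extend e xstar fun _ => false, ?_⟩)
  simp [Function.extend_comp he]

/-- The coordinate paired with `k` in the blocks `{0, 1}` and `{2, 3}`. -/
def sibling : Fin 4 → Fin 4 := ![1, 0, 3, 2]

lemma flip_of_sibling_ne : ∀ (k : Fin 4) (p : Fin 4 → Bool), p (sibling k) ≠ xstar (sibling k) →
    p ≠ xstar ∧ Function.update p k (!p k) ≠ xstar ∧
    ((∀ l, xstar l ≤ Function.update p k (!p k) l) ↔ ∀ l, xstar l ≤ p l) ∧
    ((∀ l, Function.update p k (!p k) l ≤ xstar l) ↔ ∀ l, p l ≤ xstar l) := by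
  decide

variable {f : (Fin n → Bool) → Bool} {e : Fin 4 → Fin n} {y : Fin n}

lemma blockFun_eq_of_comp_eq {x x' : Fin n → Bool} (h : x ∘ e = x' ∘ e) (hx : x ∘ e ≠ xstar)
    (hy : x y = x' y) : blockFun f e y x = blockFun f e y x' := by
  have h' : ∀ k, x (e k) = x' (e k) := fun k => congrFun h k
  rw [blockFun, blockFun, ← h, if_neg hx, if_neg hx]
  simp only [h', hy]

lemma update_comp_of_ne {j : Fin n} (hj : ∀ k, e k ≠ j) (x : Fin n → Bool) (b : Bool) :
    Function.update x j b ∘ e = x ∘ e :=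
  funext fun k => Function.update_of_ne (hj k) _ _

/-- The variable `y` of a block is strictly more influential than every other variable. -/
lemma blockFun_card_sensitive_lt (he : Function.Injective e) (hy : ∀ k, e k ≠ y) {j : Fin n}
    (hj : j ≠ y) :
    (sensitive (blockFun f e y) j).card < (sensitive (blockFun f e y) y).card := by
  let Q : Finset (Fin 4 → Bool) := Finset.univ.filter fun p =>
    ¬ (∀ k, xstar k ≤ p k) ∧ ¬ ∀ k, p k ≤ xstar k
  have hQ : Q.card = 9 := by decide
  have hQs : (Finset.univ.filter fun x : Fin n → Bool => x ∘ e ∈ Q) ⊆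
      sensitive (blockFun f e y) y := by
    intro x hx
    simp only [Q, Finset.mem_filter, Finset.mem_univ, true_and, Function.comp_apply] at hx
    have hne : x ∘ e ≠ xstar := fun h => hx.1 fun k => (congrFun h k).ge
    have hupd : ∀ k, Function.update x y (!x y) (e k) = x (e k) := fun k =>
      Function.update_of_ne (hy k) _ _
    rw [mem_sensitive, blockFun, blockFun, update_comp_of_ne hy, if_neg hne, if_neg hne]
    simp only [hupd, if_neg hx.1, if_neg hx.2]
    simp
  suffices h : ∃ P : Finset (Fin 4 → Bool), P.card ≤ 8 ∧
      sensitive (blockFun f e y) j ⊆ Finset.univ.filter fun x : Fin n → Bool => x ∘ e ∈ P by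
    obtain ⟨P, hP, hPs⟩ := h
    exact (Finset.card_le_card hPs).trans_lt <|
      (card_filter_comp_lt he (by omega)).trans_le (Finset.card_le_card hQs)
  by_cases hje : ∃ k, e k = j
  · obtain ⟨k, rfl⟩ := hje
    refine ⟨Finset.univ.filter fun p => p (sibling k) = xstar (sibling k), ?_, fun x hx => ?_⟩
    · clear hj
      revert k
      decide
    · rw [mem_sensitive] at hx
      simp only [Finset.mem_filter, Finset.mem_univ, true_and]
      by_contra hs
      obtain ⟨h1, h2, h3, h4⟩ := flip_of_sibling_ne k (x ∘ e) hs
      have hcomp : Function.update x (e k) (!x (e k)) ∘ e =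
          Function.update (x ∘ e) k (!(x ∘ e) k) := by
        funext l
        by_cases hl : l = k
        · subst hl; simp
        · simp [hl, he.ne hl]
      have hcomp' := fun l => congrFun hcomp l
      simp only [Function.comp_apply] at hcomp' h3 h4
      apply hx
      rw [blockFun, blockFun, hcomp, if_neg h1, if_neg h2, Function.update_of_ne (hy k).symm]
      simp only [hcomp', h3, h4]
  · push Not at hje
    refine ⟨{xstar}, by simp, fun x hx => ?_⟩
    rw [mem_sensitive] at hx
    simp only [Finset.mem_filter, Finset.mem_univ, true_and, Finset.mem_singleton]
    by_contra hs
    exact hx (blockFun_eq_of_comp_eq (update_comp_of_ne hje _ _).symm hs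
      (Function.update_of_ne hj.symm _ _).symm)

lemma blockFun_const_flip (hy : ∀ k, e k ≠ y) (he : Function.Injective e) (j : Fin n) (b : Bool) :
    ∃ z, blockFun f e y z = b ∧ blockFun f e y (Function.update z j (!z j)) = b := by
  have hpat : ∀ (z : Fin n → Bool) (p : Fin 4 → Bool), z ∘ e = p → p ≠ xstar →
      (if ∀ k, xstar k ≤ p k then true else if ∀ k, p k ≤ xstar k then false else z y) = b →
      blockFun f e y z = b := by
    rintro z p rfl hp hb
    rw [blockFun, if_neg hp]
    exact hb
  have hconst : ∀ d : Bool, (if ∀ k, xstar k ≤ b then true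
      else if ∀ k, b ≤ xstar k then false else d) = b := by
    clear hpat; revert b; decide
  have hne : (fun _ => b) ≠ xstar := by clear hpat hconst; revert b; decide
  refine ⟨fun _ => b, hpat _ (fun _ => b) rfl hne (hconst _), ?_⟩
  by_cases hje : ∃ k, e k = j
  · obtain ⟨k, rfl⟩ := hje
    refine hpat _ (Function.update (fun _ => b) k (!b)) ?_ ?_ ?_
    · funext l
      by_cases hl : l = k
      · subst hl; simp
      · simp [hl, he.ne hl]
    · clear hpat hconst hne; revert b k; decide
    · rw [Function.update_of_ne (hy k).symm]
      clear hpat hconst hne; revert b k; decide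
  · push Not at hje
    exact hpat _ (fun _ => b) (update_comp_of_ne hje _ _) hne (hconst _)

lemma blockFun_guarded (he : Function.Injective e) (hy : ∀ k, e k ≠ y)
    (hf : ∀ x x', (∀ i, i ≠ y → (∀ k, e k ≠ i) → x i = x' i) → f x = f x') (b : Bool) :
    Guarded f (fun x => blockFun f e y (Function.update x y b)) (Finset.univ.image e)
      (Function.extend e xstar fun _ => false) := by
  have hkey : ∀ x : Fin n → Bool, (∀ v ∈ Finset.univ.image e,
      x v = Function.extend e xstar (fun _ => false) v) ↔ x ∘ e = xstar := by
    intro x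
    simp [he.extend_apply, funext_iff]
  refine ⟨fun x x' h => hf _ _ fun i _ hi => h i (by simpa using hi), fun x hx => ?_,
    fun x x' hxx hx => ?_⟩
  · rw [hkey] at hx
    rw [blockFun, update_comp_of_ne hy, if_pos hx]
    exact hf _ _ fun i hi _ => Function.update_of_ne hi _ _
  · rw [hkey] at hx
    refine blockFun_eq_of_comp_eq ?_ (by rwa [update_comp_of_ne hy]) (by simp)
    rw [update_comp_of_ne hy, update_comp_of_ne hy]
    exact funext fun k => hxx _ (by simp)

/-- Putting a block in front of a function doubles the size of exact greedy trees. -/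
lemma blockFun_two_mul_le_size (he : Function.Injective e) (hy : ∀ k, e k ≠ y) {N : ℕ}
    (hN : ∀ b T, ExactGreedy (fun x => blockFun f e y (Function.update x y b)) T → N ≤ T.size)
    {T : BareTree n} (hT : ExactGreedy (blockFun f e y) T) : 2 * N ≤ T.size := by
  cases T with
  | leaf =>
    exfalso
    obtain ⟨b, hb⟩ := hT
    obtain ⟨z, hz, -⟩ := blockFun_const_flip (f := f) hy he y (!b)
    rw [hb] at hz
    simp at hz
  | node i t0 t1 =>
    obtain ⟨hi, hrec⟩ := hT
    have hiy : i = y := by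
      by_contra hiy
      exact (hi y).not_gt (influence_lt_of_card_lt (blockFun_card_sensitive_lt he hy hiy))
    subst hiy
    obtain ⟨h0, h1⟩ := hrec <| (influence_nonneg _ (e 0)).trans_lt
      (influence_lt_of_card_lt (blockFun_card_sensitive_lt he hy (hy 0)))
    have := hN _ _ h0
    have := hN _ _ h1
    simp only [BareTree.size]
    omega

end Block

/-! ### The chain as iterated blocks -/

section Chain

/-- `monoChainF k` as a function on a cube of arbitrary dimension. -/
def chainOn (n k : ℕ) : (Fin n → Bool) → Bool :=
  fun x => monoChainF k fun i => if hi : i < n then x ⟨i, hi⟩ else false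

lemma monoChainF_congr (k : ℕ) {x x' : ℕ → Bool} (h : ∀ i < 5 * k + 1, x i = x' i) :
    monoChainF k x = monoChainF k x' := by
  induction k with
  | zero => exact h 0 (by omega)
  | succ k ih =>
    have h1 : ∀ l : Fin 4, x (5 * k + 1 + l) = x' (5 * k + 1 + l) := fun l => h _ (by omega)
    simp only [monoChainF, h1, h (5 * k + 5) (by omega), ih fun i hi => h i (by omega)]

lemma chainOn_congr {n k : ℕ} {x x' : Fin n → Bool}
    (h : ∀ i : Fin n, (i : ℕ) < 5 * k + 1 → x i = x' i) : chainOn n k x = chainOn n k x' := by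
  refine monoChainF_congr k fun i hi => ?_
  split
  · exact h _ hi
  · rfl

/-- The `x`-variables of the block number `k`. -/
def blockVars {n k : ℕ} (hk : 5 * k + 5 < n) (l : Fin 4) : Fin n := ⟨5 * k + 1 + l, by omega⟩

lemma blockVars_injective {n k : ℕ} (hk : 5 * k + 5 < n) :
    Function.Injective (blockVars hk) := by
  intro a b h
  simp only [blockVars, Fin.mk.injEq] at h
  exact Fin.ext (by omega)

lemma blockVars_ne {n k : ℕ} (hk : 5 * k + 5 < n) (l : Fin 4) :
    blockVars hk l ≠ ⟨5 * k + 5, hk⟩ := by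
  simp only [blockVars, ne_eq, Fin.mk.injEq]
  omega

lemma chainOn_succ {n k : ℕ} (hk : 5 * k + 5 < n) :
    chainOn n (k + 1) = blockFun (chainOn n k) (blockVars hk) ⟨5 * k + 5, hk⟩ := by
  funext x
  have h1 : ∀ l : Fin 4, (if hi : 5 * k + 1 + (l : ℕ) < n then x ⟨5 * k + 1 + l, hi⟩ else false) =
      x (blockVars hk l) := fun l => dif_pos _
  simp only [chainOn, monoChainF, blockFun, h1, dif_pos hk]
  rfl

lemma chainOn_le_size {n k : ℕ} (hk : 5 * k < n) {T : BareTree n}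
    (hT : ExactGreedy (chainOn n k) T) : 2 ^ k ≤ T.size := by
  induction k generalizing T with
  | zero => exact T.one_le_size
  | succ k ih =>
    have hk' : 5 * k + 5 < n := by omega
    have he := blockVars_injective hk'
    have hy := blockVars_ne hk'
    have hf : ∀ x x' : Fin n → Bool, (∀ i, i ≠ ⟨5 * k + 5, hk'⟩ →
        (∀ l, blockVars hk' l ≠ i) → x i = x' i) → chainOn n k x = chainOn n k x' :=
      fun x x' h => chainOn_congr fun i hi => h i
        (fun h' => by rw [h'] at hi; simp at hi)
        (fun l h' => by rw [← h'] at hi; simp only [blockVars] at hi; omega)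
    rw [chainOn_succ hk'] at hT
    rw [pow_succ']
    refine blockFun_two_mul_le_size he hy (fun b S hS => ?_) hT
    rcases k with _ | k
    · exact S.one_le_size
    · refine (blockFun_guarded he hy hf b).le_size (fun T hT => ih (by omega) hT) ?_
        (w := ⟨5 * (k + 1) + 5, hk'⟩) ?_ hS
      · intro j b
        rw [chainOn_succ (by omega : 5 * k + 5 < n)]
        exact blockFun_const_flip (blockVars_ne _) (blockVars_injective _) j b
      · simpa using hy

lemma monoChainF_mono (k : ℕ) {x x' : ℕ → Bool} (h : ∀ i, x i ≤ x' i) :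
    monoChainF k x ≤ monoChainF k x' := by
  induction k with
  | zero => exact h 0
  | succ k ih =>
    have key : ∀ (a a' : Fin 4 → Bool) (u u' v v' : Bool), (∀ l, a l ≤ a' l) → u ≤ u' → v ≤ v' →
        (if a = xstar then u else if ∀ l, xstar l ≤ a l then true
          else if ∀ l, a l ≤ xstar l then false else v) ≤
        (if a' = xstar then u' else if ∀ l, xstar l ≤ a' l then true
          else if ∀ l, a' l ≤ xstar l then false else v') := by
      intro a a' u u' v v' haa hu hv
      by_cases hup' : ∀ l, xstar l ≤ a' l
      · by_cases ha' : a' = xstar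
        · subst ha'
          by_cases ha : a = xstar
          · simp [ha, hu]
          · have : ¬ ∀ l, xstar l ≤ a l := fun h => ha (funext fun l => (haa l).antisymm (h l))
            simp [ha, this, haa]
        · simp [ha', hup', Bool.le_true]
      · have ha' : a' ≠ xstar := fun h => hup' fun l => (congrFun h l).ge
        have hup : ¬ ∀ l, xstar l ≤ a l := fun h => hup' fun l => (h l).trans (haa l)
        have ha : a ≠ xstar := fun h => hup fun l => (congrFun h l).ge
        simp only [ha, ha', hup, hup', if_false]
        by_cases hd : ∀ l, a l ≤ xstar l
        · simp [hd]
        · have hd' : ¬ ∀ l, a' l ≤ xstar l := fun h => hd fun l => (haa l).trans (h l)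
          simp [hd, hd', hv]
    exact key _ _ _ _ _ _ (fun l => h _) ih (h _)

lemma exists_decTree_of_pattern {n : ℕ} (e : Fin 4 → Fin n) (t : (Fin 4 → Bool) → DecTree n)
    {N : ℕ} (ht : ∀ p, p ≠ xstar → (t p).size ≤ 2) (hN : (t xstar).size ≤ N) :
    ∃ T : DecTree n, (∀ x, T.eval x = (t (x ∘ e)).eval x) ∧ T.size ≤ N + 30 := by
  let q : Fin n → (Bool → DecTree n) → DecTree n := fun i s => .node i (s false) (s true)
  have hq : ∀ i s x, (q i s).eval x = (s (x i)).eval x := by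
    intro i s x
    cases h : x i <;> simp [q, DecTree.eval, h]
  refine ⟨q (e 0) fun b0 => q (e 1) fun b1 => q (e 2) fun b2 => q (e 3) fun b3 =>
    t ![b0, b1, b2, b3], fun x => ?_, ?_⟩
  · simp only [hq]
    congr 2
    funext k
    fin_cases k <;> rfl
  · have h : ∀ b0 b1 b2 b3, (t ![b0, b1, b2, b3]).size ≤
        if ![b0, b1, b2, b3] = xstar then N else 2 := by
      intro b0 b1 b2 b3
      split_ifs with h
      · rw [h]; exact hN
      · exact ht _ h
    have h' : ∀ b0 b1 b2 b3, ![b0, b1, b2, b3] = xstar ↔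
        b0 = false ∧ b1 = false ∧ b2 = true ∧ b3 = true := by
      decide
    simp only [h'] at h
    simp only [q, DecTree.size]
    have a0 := h false false false false
    have a1 := h false false false true
    have a2 := h false false true false
    have a3 := h false false true true
    have a4 := h false true false false
    have a5 := h false true false true
    have a6 := h false true true false
    have a7 := h false true true true
    have a8 := h true false false false
    have a9 := h true false false true
    have a10 := h true false true false
    have a11 := h true false true true
    have a12 := h true true false false
    have a13 := h true true false true
    have a14 := h true true true false
    have a15 := h true true true true
    simp only [Bool.false_eq_true, Bool.true_eq_false, and_true, and_false,
      and_self, if_true, if_false] at *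
    omega

lemma exists_decTree_chainOn {n k : ℕ} (hk : 5 * k < n) :
    ∃ T : DecTree n, (∀ x, T.eval x = chainOn n k x) ∧ T.size ≤ 30 * k + 30 := by
  induction k with
  | zero =>
    refine ⟨.node ⟨0, hk⟩ (.leaf false) (.leaf true), fun x => ?_, by simp [DecTree.size]⟩
    have hn : 0 < n := hk
    cases h : x ⟨0, hn⟩ <;> simp [DecTree.eval, chainOn, monoChainF, hn, h]
  | succ k ih =>
    obtain ⟨T, hT, hs⟩ := ih (by omega)
    have hk' : 5 * k + 5 < n := by omega
    obtain ⟨T', hT', hs'⟩ := exists_decTree_of_pattern (blockVars hk') (N := 30 * k + 30)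
      (fun p => if p = xstar then T else if ∀ l, xstar l ≤ p l then .leaf true
        else if ∀ l, p l ≤ xstar l then .leaf false
        else .node ⟨5 * k + 5, hk'⟩ (.leaf false) (.leaf true))
      (fun p hp => by
        simp only [if_neg hp]
        split_ifs <;> simp [DecTree.size])
      (by simpa using hs)
    refine ⟨T', fun x => ?_, by omega⟩
    rw [hT', chainOn_succ hk', blockFun]
    simp only [Function.comp_apply]
    split_ifs
    · exact hT x
    · rfl
    · rfl
    · cases h : x ⟨5 * k + 5, hk'⟩ <;> simp [DecTree.eval, h]

end Chain

end TopDownDT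

/-- Each `f_h` is monotone and has optimal decision tree size at most
`C·h + C` for an absolute constant `C`, yet `BuildTopDownDT(f_h, 0)` — regardless of
how ties are broken — outputs a tree of size at least `2^h`. -/
theorem mono_chain_exact_separation :
    ∃ C : ℕ, 0 < C ∧ ∀ h : ℕ, 1 ≤ h →
      MonotoneBF (monoChainFun h) ∧
      optSize (monoChainFun h) ≤ C * h + C ∧
      ∀ (m : ℕ) (g : ℕ → BareTree (5 * h + 1)),
        IsRun (monoChainFun h) 0 m g →
        completionErr (monoChainFun h) (g m) ≤ 0 →
        2 ^ h ≤ (g m).size := by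
  refine ⟨30, by norm_num, fun h _ => ⟨fun x x' hx => ?_, ?_, fun m g hg herr => ?_⟩⟩
  · refine monoChainF_mono h fun i => ?_
    split
    · exact hx _
    · exact le_rfl
  · obtain ⟨T, hT, hs⟩ := exists_decTree_chainOn (n := 5 * h + 1) (k := h) (by omega)
    have hle : optSize (monoChainFun h) ≤ T.size := Nat.sInf_le ⟨T, hT, rfl⟩
    exact hle.trans hs
  · exact chainOn_le_size (by omega) (hg.exactGreedy herr)
end
end

section
/- Let f : {0,1}^n → {±1} be a non-constant function computable by a decision tree of size s. Then its total influence satisfies Inf(f) ≤ Var(f)·log₂(4s/Var(f)). -/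
/- Common definitions: decision trees, bare trees, influence, and the
   BuildTopDownDT top-down heuristic (modelled as a nondeterministic step
   relation, so that all tie-breakings are covered). -/

noncomputable section

open TopDownDT

namespace TopDownDT

/-- Flip the `i`-th bit of `x`. -/
def flipBit {n : ℕ} (i : Fin n) (x : Fin n → Bool) : Fin n → Bool :=
  Function.update x i (!x i)

lemma flipBit_involutive {n : ℕ} (i : Fin n) : Function.Involutive (flipBit i) := by
  intro x
  simp [flipBit]

lemma sum_flipBit {n : ℕ} {M : Type*} [AddCommMonoid M] (i : Fin n) (F : (Fin n → Bool) → M) :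
    ∑ x, F (flipBit i x) = ∑ x, F x :=
  Equiv.sum_comp (flipBit_involutive i).toPerm F

/-- The sensitivity of `f` at `x`. -/
def sens {n : ℕ} (f : (Fin n → Bool) → Bool) (x : Fin n → Bool) : ℕ :=
  (Finset.univ.filter fun i => f x ≠ f (flipBit i x)).card

/-- Fixing a variable does not increase decision tree size. -/
lemma DecTree.exists_restrict {n : ℕ} (i : Fin n) (b : Bool) (T : DecTree n) :
    ∃ T' : DecTree n, T'.size ≤ T.size ∧ ∀ x, T'.eval x = T.eval (Function.update x i b) := by
  induction T with
  | leaf c => exact ⟨.leaf c, le_rfl, fun x => rfl⟩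
  | node j t0 t1 ih0 ih1 =>
    obtain ⟨r0, h0, e0⟩ := ih0
    obtain ⟨r1, h1, e1⟩ := ih1
    by_cases hj : j = i
    · subst hj
      cases b
      · exact ⟨r0, h0.trans (by simp [DecTree.size]), fun x => by simp [DecTree.eval, e0]⟩
      · exact ⟨r1, h1.trans (by simp [DecTree.size]), fun x => by simp [DecTree.eval, e1]⟩
    · exact ⟨.node j r0 r1, by simp only [DecTree.size]; omega,
        fun x => by simp [DecTree.eval, e0, e1, Function.update_of_ne hj]⟩

lemma DecTree.size_pos {n : ℕ} (T : DecTree n) : 0 < T.size := by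
  induction T with
  | leaf c => exact Nat.one_pos
  | node j t0 t1 ih0 ih1 => simp only [DecTree.size]; omega

/-- Fixing a variable to its current value lowers the sensitivity by at most one. -/
lemma sens_le_sens_update_add_one {n : ℕ} (f : (Fin n → Bool) → Bool) (i : Fin n)
    (x : Fin n → Bool) :
    sens f x ≤ sens (fun y => f (Function.update y i (x i))) x + 1 := by
  unfold sens
  refine (Finset.card_le_card (t := insert i _) ?_).trans (Finset.card_insert_le _ _)
  intro j hj
  simp only [Finset.mem_filter, Finset.mem_univ, true_and, Finset.mem_insert] at hj ⊢
  refine or_iff_not_imp_left.mpr fun hji => ?_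
  have h : Function.update (flipBit j x) i (x i) = flipBit j x := by
    have : flipBit j x i = x i := Function.update_of_ne (Ne.symm hji) _ _
    rw [← this, Function.update_eq_self]
  rwa [Function.update_eq_self, h]

lemma update_flipBit {n : ℕ} (i : Fin n) (b : Bool) (x : Fin n → Bool) :
    Function.update (flipBit i x) i b = Function.update x i b := by
  simp [flipBit]

/-- The sensitivity of a function that ignores variable `i` also ignores variable `i`. -/
lemma sens_update_flipBit {n : ℕ} (f : (Fin n → Bool) → Bool) (i : Fin n) (b : Bool)
    (x : Fin n → Bool) :
    sens (fun y => f (Function.update y i b)) (flipBit i x) =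
      sens (fun y => f (Function.update y i b)) x := by
  have key : ∀ j, Function.update (flipBit j (flipBit i x)) i b =
      Function.update (flipBit j x) i b := by
    intro j
    ext k
    simp only [flipBit, Function.update_apply]
    split_ifs <;> simp_all
  unfold sens
  simp only [update_flipBit, key]

/-- A function with a decision tree of size `s` satisfies `E[2 ^ sens] ≤ s`. -/
lemma sum_two_pow_sens_le {n : ℕ} (f : (Fin n → Bool) → Bool) (T : DecTree n)
    (hT : ∀ x, T.eval x = f x) : ∑ x, 2 ^ sens f x ≤ T.size * 2 ^ n := by
  induction hs : T.size using Nat.strong_induction_on generalizing f T with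
  | _ s ih =>
  cases T with
  | leaf c =>
    have h : ∀ x, sens f x = 0 := fun x => by simp [sens, ← hT, DecTree.eval]
    simp [h, ← hs, DecTree.size]
  | node i t0 t1 =>
    simp only [DecTree.size] at hs
    have p0 := t0.size_pos
    have p1 := t1.size_pos
    have step : ∀ (b : Bool) (t : DecTree n), t.size < s →
        (∀ x, t.eval (Function.update x i b) = f (Function.update x i b)) →
        ∑ x, 2 ^ sens (fun y => f (Function.update y i b)) x ≤ t.size * 2 ^ n := by
      intro b t ht he
      obtain ⟨r, hr, er⟩ := t.exists_restrict i b
      exact (ih r.size (by omega) _ r (fun x => by rw [er, he]) rfl).trans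
        (Nat.mul_le_mul_right _ hr)
    have b0 := step false t0 (by omega) fun x => by simp [← hT, DecTree.eval]
    have b1 := step true t1 (by omega) fun x => by simp [← hT, DecTree.eval]
    have point : ∀ x, 2 ^ sens f x + 2 ^ sens f (flipBit i x) ≤
        2 * (2 ^ sens (fun y => f (Function.update y i false)) x +
          2 ^ sens (fun y => f (Function.update y i true)) x) := by
      intro x
      have h1 := Nat.pow_le_pow_right (n := 2) (by norm_num) (sens_le_sens_update_add_one f i x)
      have h2 := Nat.pow_le_pow_right (n := 2) (by norm_num)
        (sens_le_sens_update_add_one f i (flipBit i x))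
      rw [sens_update_flipBit] at h2
      have hx : flipBit i x i = !x i := Function.update_self _ _ _
      rw [hx] at h2
      rw [pow_succ] at h1 h2
      cases hxi : x i <;> simp only [hxi, Bool.not_true, Bool.not_false] at h1 h2 <;> omega
    have total := Finset.sum_le_sum fun x (_ : x ∈ Finset.univ) => point x
    rw [Finset.sum_add_distrib, sum_flipBit i fun x => 2 ^ sens f x, ← Finset.mul_sum,
      Finset.sum_add_distrib] at total
    rw [← hs, add_mul]
    omega

/-- The points of `f ⁻¹ {b}`. -/
def fiber {n : ℕ} (f : (Fin n → Bool) → Bool) (b : Bool) : Finset (Fin n → Bool) :=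
  Finset.univ.filter fun x => f x = b

/-- Every sensitive edge has exactly one endpoint in `f ⁻¹ {b}`. -/
lemma totalInfluence_eq_sum_fiber {n : ℕ} (f : (Fin n → Bool) → Bool) (b : Bool) :
    totalInfluence f = 2 * (∑ x ∈ fiber f b, (sens f x : ℝ)) / 2 ^ n := by
  have edge : ∀ i, ((Finset.univ.filter fun x => f x ≠ f (flipBit i x)).card : ℝ) =
      2 * ∑ x ∈ fiber f b, if f x ≠ f (flipBit i x) then (1 : ℝ) else 0 := by
    intro i
    rw [Finset.card_filter, fiber, Finset.sum_filter, two_mul]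
    push_cast
    nth_rw 2 [← sum_flipBit i]
    rw [← Finset.sum_add_distrib]
    refine Finset.sum_congr rfl fun x _ => ?_
    rw [flipBit_involutive i x]
    cases f x <;> cases f (flipBit i x) <;> cases b <;> simp
  unfold totalInfluence influence
  rw [← Finset.sum_div, Fintype.card_fin]
  congr 1
  refine (Finset.sum_congr rfl fun i _ => edge i).trans ?_
  rw [← Finset.mul_sum, Finset.sum_comm]
  simp only [sens, Finset.card_filter, Nat.cast_sum, Nat.cast_ite, Nat.cast_one, Nat.cast_zero]

/-- Jensen's inequality for `2 ^ k` over a finite set. -/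
lemma sum_le_card_mul_logb {α : Type*} (S : Finset α) (hS : S.Nonempty) (k : α → ℕ) (B : ℝ)
    (hB : ∑ x ∈ S, (2 : ℝ) ^ k x ≤ B) :
    ∑ x ∈ S, (k x : ℝ) ≤ S.card * Real.logb 2 (B / S.card) := by
  have hc : (0 : ℝ) < S.card := by exact_mod_cast hS.card_pos
  have hBpos : 0 < B := (Finset.sum_pos (fun x _ => by positivity) hS).trans_le hB
  have hl : 0 < Real.log 2 := Real.log_pos (by norm_num)
  have hm : 0 < B / S.card := by positivity
  have point : ∀ x ∈ S, (k x : ℝ) * Real.log 2 - Real.log (B / S.card) ≤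
      2 ^ k x / (B / S.card) - 1 := by
    intro x _
    have h := Real.log_le_sub_one_of_pos (x := 2 ^ k x / (B / S.card)) (by positivity)
    rwa [Real.log_div (by positivity) hm.ne', Real.log_pow] at h
  have total := Finset.sum_le_sum point
  rw [Finset.sum_sub_distrib, Finset.sum_sub_distrib, ← Finset.sum_mul, ← Finset.sum_div,
    Finset.sum_const, Finset.sum_const, nsmul_eq_mul, nsmul_eq_mul, mul_one] at total
  have hle : (∑ x ∈ S, (2 : ℝ) ^ k x) / (B / S.card) ≤ S.card := by
    rw [div_le_iff₀ hm, mul_div_cancel₀ _ hc.ne']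
    exact hB
  rw [Real.logb, ← mul_div_assoc, le_div_iff₀ hl]
  linarith

lemma totalInfluence_le_fiber {n : ℕ} (f : (Fin n → Bool) → Bool) (T : DecTree n)
    (hT : ∀ x, T.eval x = f x) (b : Bool) (hb : (fiber f b).Nonempty) :
    totalInfluence f ≤ 2 * ((fiber f b).card / 2 ^ n : ℝ) *
      Real.logb 2 (T.size / ((fiber f b).card / 2 ^ n : ℝ)) := by
  have hsum : ∑ x ∈ fiber f b, (2 : ℝ) ^ sens f x ≤ T.size * 2 ^ n := by
    refine (Finset.sum_le_univ_sum_of_nonneg fun x => by positivity).trans ?_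
    exact_mod_cast sum_two_pow_sens_le f T hT
  have h := sum_le_card_mul_logb _ hb (sens f) _ hsum
  rw [totalInfluence_eq_sum_fiber f b, div_le_iff₀ (by positivity), div_div_eq_mul_div]
  refine (mul_le_mul_of_nonneg_left h zero_le_two).trans_eq ?_
  field_simp

lemma card_fiber_add_card_fiber {n : ℕ} (f : (Fin n → Bool) → Bool) :
    (fiber f false).card + (fiber f true).card = 2 ^ n := by
  have h := Finset.card_filter_add_card_filter_not (s := Finset.univ) fun x => f x = false
  simpa [fiber] using h

lemma two_mul_logb_le {p q s : ℝ} (hp : 0 < p) (hpq : p + q = 1) (h : p ≤ q) (hs : 1 ≤ s) :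
    2 * p * Real.logb 2 (s / p) ≤ 4 * q * p * Real.logb 2 (4 * s / (4 * q * p)) := by
  have hq : 0 < q := hp.trans_le h
  have h1 : 1 ≤ s / p := by rw [le_div_iff₀ hp]; linarith
  have h2 : s / p ≤ 4 * s / (4 * q * p) := by
    rw [mul_assoc, mul_div_mul_left _ _ four_ne_zero]
    exact div_le_div_of_nonneg_left (by linarith) (by positivity) (by nlinarith)
  have hlog : Real.logb 2 (s / p) ≤ Real.logb 2 (4 * s / (4 * q * p)) :=
    Real.logb_le_logb_of_le (by norm_num) (by linarith) h2
  exact mul_le_mul (by nlinarith) hlog (Real.logb_nonneg (by norm_num) h1) (by positivity)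

end TopDownDT

/-- If `f` is non-constant and computable by a decision tree of
size `s`, then `Inf(f) ≤ Var(f)·log₂(4s/Var(f))`. -/
theorem totalInfluence_le_var_mul_log
    {n : ℕ} (f : (Fin n → Bool) → Bool) (hnc : ∃ x y, f x ≠ f y)
    (s : ℕ) (T : DecTree n) (hT : ∀ x, T.eval x = f x) (hTs : T.size = s) :
    totalInfluence f ≤ varf f * Real.logb 2 (4 * s / varf f) := by
  subst hTs
  have hne : ∀ b, (fiber f b).Nonempty := by
    intro b
    obtain ⟨x, y, hxy⟩ := hnc
    by_cases hx : f x = b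
    · exact ⟨x, by simp [fiber, hx]⟩
    · exact ⟨y, by
        simp only [fiber, Finset.mem_filter, Finset.mem_univ, true_and]
        cases b <;> simp_all⟩
  have hpos : ∀ b, (0 : ℝ) < (fiber f b).card / 2 ^ n := fun b =>
    div_pos (by exact_mod_cast (hne b).card_pos) (by positivity)
  have hsum : ((fiber f false).card / 2 ^ n : ℝ) + (fiber f true).card / 2 ^ n = 1 := by
    rw [← add_div, div_eq_one_iff_eq (by positivity)]
    exact_mod_cast card_fiber_add_card_fiber f
  have hs : (1 : ℝ) ≤ T.size := by exact_mod_cast T.size_pos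
  have hvar : varf f = 4 * ((fiber f false).card / 2 ^ n : ℝ) * ((fiber f true).card / 2 ^ n) :=
    rfl
  rcases le_total ((fiber f false).card / 2 ^ n : ℝ) ((fiber f true).card / 2 ^ n) with h | h
  · rw [hvar, mul_right_comm 4]
    exact (totalInfluence_le_fiber f T hT false (hne _)).trans
      (two_mul_logb_le (hpos _) hsum h hs)
  · rw [hvar]
    exact (totalInfluence_le_fiber f T hT true (hne _)).trans
      (two_mul_logb_le (hpos _) (by rw [add_comm]; exact hsum) h hs)
end
end

section
/- Let S ⊆ [n] and let f : {0,1}^{[n]∖S} × {0,1}^S → {±1}, f̃ : {0,1}^S → {±1}, and g : {0,1}^{[n]∖S} × {±1} → {±1} satisfy f(a,b) = g(a, f̃(b)) for all a, b. Let π be any restriction fixing a subset of the variables, and suppose Pr_{a}[g_{π}(a,−1) ≠ g_{π}(a,1)] > 0, where g_π is g with the coordinates of [n]∖S fixed according to π. Then the composed structure is preserved under π, and for all variables v₁, v₂ ∈ S left free by π: Inf_{v₁}(f̃_π) ≥ Inf_{v₂}(f̃_π) if and only if Inf_{v₁}(f_π) ≥ Inf_{v₂}(f_π), where h_π denotes h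 with the variables in π fixed accordingly. -/
/- Common definitions: decision trees, bare trees, influence, and the
   BuildTopDownDT top-down heuristic (modelled as a nondeterministic step
   relation, so that all tie-breakings are covered). -/

noncomputable section

open TopDownDT

/-- Restriction of a Boolean function: fix the coordinates in `F` according to `ρ`
(as a function on the whole cube; the fixed coordinates become irrelevant). -/
def restrictOn {I : Type} [DecidableEq I]
    (h : (I → Bool) → Bool) (F : Finset I) (ρ : I → Bool) : (I → Bool) → Bool :=
  fun x => h fun i => if i ∈ F then ρ i else x i

/-- If the outer function depends on the inner one only through its value, then the influence of
an inner variable on the composition is its influence on the inner function, scaled by the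
probability that the outer function is sensitive to the inner value. -/
theorem influence_comp_inr
    {A B : Type} [Fintype A] [DecidableEq A] [Fintype B] [DecidableEq B]
    (G : (A → Bool) → Bool → Bool) (t : (B → Bool) → Bool) (v : B) :
    influence (fun x : A ⊕ B → Bool =>
        G (fun a => x (Sum.inl a)) (t fun b => x (Sum.inr b))) (Sum.inr v) =
      ((Finset.univ.filter fun a : A → Bool => G a false ≠ G a true).card : ℝ) /
        2 ^ Fintype.card A * influence t v := by
  have hcard : (Finset.univ.filter fun x : A ⊕ B → Bool =>
      G (fun a => x (Sum.inl a)) (t fun b => x (Sum.inr b)) ≠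
        G (fun a => Function.update x (Sum.inr v) (!x (Sum.inr v)) (Sum.inl a))
          (t fun b => Function.update x (Sum.inr v) (!x (Sum.inr v)) (Sum.inr b))).card =
      (Finset.univ.filter fun a : A → Bool => G a false ≠ G a true).card *
        (Finset.univ.filter fun y : B → Bool =>
          t y ≠ t (Function.update y v (!y v))).card := by
    rw [← Finset.card_product]
    refine Finset.card_equiv (Equiv.sumArrowEquivProdArrow A B Bool) fun x => ?_
    have hinl : (fun a => Function.update x (Sum.inr v) (!x (Sum.inr v)) (Sum.inl a)) =
        fun a => x (Sum.inl a) := by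
      funext a
      simp
    have hinr : (fun b => Function.update x (Sum.inr v) (!x (Sum.inr v)) (Sum.inr b)) =
        Function.update (fun b => x (Sum.inr b)) v (!x (Sum.inr v)) := by
      funext b
      simp [Function.update_apply]
    simp only [Finset.mem_filter, Finset.mem_univ, true_and, Finset.mem_product, hinl, hinr,
      Equiv.sumArrowEquivProdArrow, Equiv.coe_fn_mk, Function.comp_def]
    cases t (fun b => x (Sum.inr b)) <;>
      cases t (Function.update (fun b => x (Sum.inr b)) v (!x (Sum.inr v))) <;>
      simp [eq_comm]
  unfold influence
  rw [hcard, Fintype.card_sum, pow_add]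
  push_cast
  rw [mul_div_mul_comm]

/-- If `f(a,b) = g(a, f̃(b))` and `π = (F, ρ)` is any restriction
such that the restricted outer function `g_π` satisfies `Pr_a[g_π(a,−1) ≠ g_π(a,1)] > 0`,
then for all variables `v₁, v₂` of the inner block `B` left free by `π`, the influence
order is the same in `f̃_π` and in `f_π`. -/
theorem influence_order_preserved_under_restriction
    {A B : Type} [Fintype A] [DecidableEq A] [Fintype B] [DecidableEq B]
    (f : (A ⊕ B → Bool) → Bool) (ftil : (B → Bool) → Bool)
    (g : (A → Bool) → Bool → Bool)
    (hfg : ∀ x : A ⊕ B → Bool,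
      f x = g (fun a => x (Sum.inl a)) (ftil fun b => x (Sum.inr b)))
    (F : Finset (A ⊕ B)) (ρ : A ⊕ B → Bool)
    (hpos : 0 <
      ((Finset.univ.filter fun a : A → Bool =>
          g (fun i => if Sum.inl i ∈ F then ρ (Sum.inl i) else a i) false ≠
          g (fun i => if Sum.inl i ∈ F then ρ (Sum.inl i) else a i) true).card : ℝ) /
        2 ^ Fintype.card A) :
    ∀ v₁ v₂ : B, Sum.inr v₁ ∉ F → Sum.inr v₂ ∉ F →
      (influence (restrictOn ftil (Finset.univ.filter fun b : B => Sum.inr b ∈ F)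
            (fun b => ρ (Sum.inr b))) v₂ ≤
        influence (restrictOn ftil (Finset.univ.filter fun b : B => Sum.inr b ∈ F)
            (fun b => ρ (Sum.inr b))) v₁ ↔
        influence (restrictOn f F ρ) (Sum.inr v₂) ≤
          influence (restrictOn f F ρ) (Sum.inr v₁)) := by
  intro v₁ v₂ _ _
  have hcomp : ∀ x : A ⊕ B → Bool, restrictOn f F ρ x =
      g (fun i => if Sum.inl i ∈ F then ρ (Sum.inl i) else x (Sum.inl i))
        (restrictOn ftil (Finset.univ.filter fun b : B => Sum.inr b ∈ F)
          (fun b => ρ (Sum.inr b)) fun b => x (Sum.inr b)) := fun x => by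
    simp [restrictOn, hfg]
  have hinf := influence_comp_inr
    (fun a => g fun i => if Sum.inl i ∈ F then ρ (Sum.inl i) else a i)
    (restrictOn ftil (Finset.univ.filter fun b : B => Sum.inr b ∈ F) fun b => ρ (Sum.inr b))
  rw [funext hcomp, hinf v₁, hinf v₂]
  exact (mul_le_mul_iff_right₀ hpos).symm
end
end

section
/- Let T be a decision tree computing f : {0,1}^n → {±1}, and let Δ(T) = E_x[depth of the leaf of T reached by x] (x uniform) be its average depth. Then the total influence of f satisfies Inf(f) ≤ Δ(T). (The proof shows that for every x, the sensitivity sens_f(x) is at most the depth of the leaf of T that x reaches.) -/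
/- Common definitions: decision trees, bare trees, influence, and the
   BuildTopDownDT top-down heuristic (modelled as a nondeterministic step
   relation, so that all tie-breakings are covered). -/

noncomputable section

open TopDownDT

/-- Average depth `Δ(T) = E_x[depth of the leaf of T reached by x]` (uniform `x`). -/
def avgDepth {n : ℕ} (T : DecTree n) : ℝ :=
  (∑ x : Fin n → Bool, (T.pathLen x : ℝ)) / 2 ^ n

/-- The sensitivity at `x` of the function computed by a decision tree is at most the number of
queries made on `x`. -/
theorem TopDownDT.DecTree.card_sensitive_le_pathLen {n : ℕ} (T : DecTree n) (x : Fin n → Bool) :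
    (Finset.univ.filter fun i : Fin n =>
      T.eval x ≠ T.eval (Function.update x i (!x i))).card ≤ T.pathLen x := by
  induction T with
  | leaf b => simp [DecTree.eval]
  | node j t0 t1 ih0 ih1 =>
    cases hx : x j
    all_goals
      simp only [DecTree.pathLen, hx, if_true, Bool.false_eq_true, if_false]
    case' false => refine le_trans ?_ (Nat.succ_le_succ ih0)
    case' true => refine le_trans ?_ (Nat.succ_le_succ ih1)
    all_goals
      refine le_trans (Finset.card_le_card fun i hi => ?_) (Finset.card_insert_le j _)
      rcases eq_or_ne i j with rfl | hij
      · exact Finset.mem_insert_self _ _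
      · simpa [DecTree.eval, hx, Function.update_of_ne hij.symm, hij] using hi

/-- If the decision tree `T` computes `f : {0,1}ⁿ → {±1}`, then
the total influence of `f` is at most the average depth of `T`:
`Inf(f) ≤ Δ(T)`. -/
theorem totalInfluence_le_avgDepth
    {n : ℕ} (T : DecTree n) (f : (Fin n → Bool) → Bool)
    (hT : ∀ x, T.eval x = f x) :
    totalInfluence f ≤ avgDepth T := by
  obtain rfl : T.eval = f := funext hT
  simp only [totalInfluence, influence, avgDepth, ← Finset.sum_div, Fintype.card_fin]
  gcongr
  norm_cast
  calc
    _ = ∑ x : Fin n → Bool, (Finset.univ.filter fun i : Fin n =>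
          T.eval x ≠ T.eval (Function.update x i (!x i))).card := by
      simp only [Finset.card_filter]
      exact Finset.sum_comm
    _ ≤ _ := Finset.sum_le_sum fun x _ => T.card_sensitive_le_pathLen x
end
end
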